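/- Let p > 3 be a prime. Then ∑_{k=0}^{p-1} T_k(4,1)^2 / 4^k ≡ (-1/p) (mod p^2) and ∑_{k=0}^{p-1} T_k(4,1)^2 / 36^k ≡ (-1/p) (mod p^2), where (-1/p) = (-1)^{(p-1)/2} is the Legendre symbol and both sums are p-adic integers. -/

import Mathlib

/-- The generalized central trinomial coefficient `T_n(b,c)`, the coefficient of `x^n`
in `(x^2 + b*x + c)^n`. -/
def genCentralTrinomial (b c : ℤ) (n : ℕ) : ℤ :=
  ∑ k ∈ Finset.range (n / 2 + 1),
    (n.choose (2 * k) : ℤ) * ((2 * k).choose k : ℤ) * b ^ (n - 2 * k) * c ^ k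

open Finset

/-- The summands of `T_n(4,1)`, as rational numbers without truncated exponents. -/
def trinomialTerm (n k : ℕ) : ℚ :=
  (n.choose (2 * k) : ℚ) * k.centralBinom * 4 ^ n / 16 ^ k

/-- The summands in the expansion of `T_n(4,1) ^ 2`. -/
def trinomialSqTerm (n k : ℕ) : ℚ :=
  ((n + k).choose (2 * k) : ℚ) * k.centralBinom ^ 2 * 12 ^ n / 12 ^ k

lemma cast_choose_mul_succ (n k : ℕ) :
    (n.choose k : ℚ) * (n + 1) = (n + 1).choose k * (n + 1 - k) := by
  rcases le_or_gt k (n + 1) with h | h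
  · have := Nat.choose_mul_succ_eq n k
    have h2 : ((n + 1 - k : ℕ) : ℚ) = n + 1 - k := by push_cast [Nat.cast_sub h]; ring
    rw [← h2]
    exact_mod_cast this
  · rw [Nat.choose_eq_zero_of_lt h, Nat.choose_eq_zero_of_lt (by lia)]
    simp

lemma cast_choose_succ_right (n k : ℕ) :
    (n.choose (k + 1) : ℚ) * (k + 1) = n.choose k * (n - k) := by
  rcases le_or_gt k n with h | h
  · rw [← Nat.cast_sub h]
    exact_mod_cast Nat.choose_succ_right_eq n k
  · rw [Nat.choose_eq_zero_of_lt h, Nat.choose_eq_zero_of_lt (by lia)]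
    simp

lemma cast_succ_mul_centralBinom_succ {R : Type*} [CommSemiring R] (k : ℕ) :
    ((k : R) + 1) * (k + 1).centralBinom = 2 * (2 * k + 1) * k.centralBinom := by
  exact_mod_cast congrArg (Nat.cast (R := R)) (Nat.succ_mul_centralBinom_succ k)

lemma trinomialTerm_succ_left (n k : ℕ) :
    4 * (n + 1) * trinomialTerm n k = (n + 1 - 2 * k) * trinomialTerm (n + 1) k := by
  have := cast_choose_mul_succ n (2 * k)
  push_cast at this
  unfold trinomialTerm
  rw [pow_succ]
  linear_combination (4 * k.centralBinom * 4 ^ n / 16 ^ k : ℚ) * this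

lemma trinomialTerm_succ_right (n k : ℕ) :
    16 * (k + 1) ^ 2 * trinomialTerm n (k + 1)
      = (n - 2 * k) * (n - 2 * k - 1) * trinomialTerm n k := by
  have h1 := cast_choose_succ_right n (2 * k)
  have h2 := cast_choose_succ_right n (2 * k + 1)
  have h3 := cast_succ_mul_centralBinom_succ (R := ℚ) k
  push_cast at h1 h2
  unfold trinomialTerm
  rw [pow_succ, show 2 * (k + 1) = 2 * k + 1 + 1 by ring]
  have h4 : (2 * (k : ℚ) + 1) ≠ 0 := by positivity
  have h5 : ((k : ℚ) + 1) ≠ 0 := by positivity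
  have e1 : (n.choose (2 * k + 1) : ℚ) = n.choose (2 * k) * (n - 2 * k) / (2 * k + 1) := by
    rw [eq_div_iff h4, h1]
  have e2 : (n.choose (2 * k + 1 + 1) : ℚ) =
      n.choose (2 * k + 1) * (n - (2 * k + 1)) / (2 * (k + 1)) := by
    rw [eq_div_iff (by positivity), ← h2]; ring
  have e3 : ((k + 1).centralBinom : ℚ) = 2 * (2 * k + 1) * k.centralBinom / (k + 1) := by
    rw [eq_div_iff h5, ← h3]; ring
  rw [e2, e1, e3]
  field_simp
  ring

lemma trinomialTerm_eq_zero {n k : ℕ} (h : n < 2 * k) : trinomialTerm n k = 0 := by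
  simp [trinomialTerm, Nat.choose_eq_zero_of_lt h]

lemma genCentralTrinomial_four_one (n K : ℕ) (hK : n < 2 * K) :
    (genCentralTrinomial 4 1 n : ℚ) = ∑ k ∈ range K, trinomialTerm n k := by
  have hsub : range (n / 2 + 1) ⊆ range K := range_subset_range.2 (by lia)
  rw [← sum_subset hsub]
  · unfold genCentralTrinomial
    push_cast
    refine sum_congr rfl fun k hk => ?_
    have hk : 2 * k ≤ n := by have := mem_range.1 hk; lia
    rw [trinomialTerm, Nat.centralBinom_eq_two_mul_choose, eq_div_iff (by positivity), one_pow,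
      show (16 : ℚ) = 4 ^ 2 by norm_num, ← pow_mul]
    have h4 : (4 : ℚ) ^ n = 4 ^ (n - 2 * k) * 4 ^ (2 * k) := by
      rw [← pow_add, Nat.sub_add_cancel hk]
    rw [h4]
    ring
  · intro k _ hk
    exact trinomialTerm_eq_zero (by have := mt mem_range.2 hk; lia)

lemma genCentralTrinomial_four_one_rec (n : ℕ) :
    ((n : ℚ) + 2) * genCentralTrinomial 4 1 (n + 2)
      = 4 * (2 * n + 3) * genCentralTrinomial 4 1 (n + 1)
        - 12 * (n + 1) * genCentralTrinomial 4 1 n := by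
  rw [genCentralTrinomial_four_one (n + 2) (n + 3) (by lia),
    genCentralTrinomial_four_one (n + 1) (n + 3) (by lia),
    genCentralTrinomial_four_one n (n + 3) (by lia)]
  rw [← sub_eq_zero, mul_sum, mul_sum, mul_sum, ← sum_sub_distrib, ← sum_sub_distrib]
  set G : ℕ → ℚ := fun j => -4 * (j : ℚ) ^ 2 * trinomialTerm (n + 2) j / (n + 2) with hG
  have key : ∀ k ∈ range (n + 3),
      ((n : ℚ) + 2) * trinomialTerm (n + 2) k -
        (4 * (2 * n + 3) * trinomialTerm (n + 1) k - 12 * (n + 1) * trinomialTerm n k)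
      = G (k + 1) - G k := by
    intro k _
    simp only [hG]
    have h1 := trinomialTerm_succ_left n k
    have h2 := trinomialTerm_succ_left (n + 1) k
    have h3 := trinomialTerm_succ_right (n + 2) k
    push_cast at h1 h2 h3 ⊢
    have hn : (n : ℚ) + 2 ≠ 0 := by positivity
    field_simp
    linear_combination (-(2 * (n : ℚ) + 3) + 3 / 4 * (n + 1 - 2 * k)) * h2
      + 3 * (n + 2) * h1 + (1 / 4 : ℚ) * h3
  rw [sum_congr rfl key, sum_range_sub]
  simp [hG, trinomialTerm_eq_zero (show n + 2 < 2 * (n + 3) by lia)]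

lemma trinomialSqTerm_succ_left (n k : ℕ) :
    12 * (n + 1 + k) * trinomialSqTerm n k = (n + 1 - k) * trinomialSqTerm (n + 1) k := by
  have := cast_choose_mul_succ (n + k) (2 * k)
  push_cast at this
  unfold trinomialSqTerm
  rw [pow_succ, show n + 1 + k = n + k + 1 by ring]
  linear_combination (12 * k.centralBinom ^ 2 * 12 ^ n / 12 ^ k : ℚ) * this

lemma trinomialSqTerm_succ_right (n k : ℕ) :
    6 * (k + 1) ^ 3 * trinomialSqTerm n (k + 1)
      = (2 * k + 1) * (n + k + 1) * (n - k) * trinomialSqTerm n k := by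
  have h1 := cast_choose_succ_right (n + k) (2 * k)
  have h2 : ((n + k + 1).choose (2 * k + 1 + 1) : ℚ) * (2 * k + 1 + 1)
      = (n + k + 1) * (n + k).choose (2 * k + 1) := by
    exact_mod_cast (Nat.add_one_mul_choose_eq (n + k) (2 * k + 1)).symm
  have h3 := cast_succ_mul_centralBinom_succ (R := ℚ) k
  push_cast at h1 h2
  unfold trinomialSqTerm
  rw [pow_succ, show 2 * (k + 1) = 2 * k + 1 + 1 by ring, show n + (k + 1) = n + k + 1 by ring]
  have h4 : (2 * (k : ℚ) + 1) ≠ 0 := by positivity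
  have h5 : ((k : ℚ) + 1) ≠ 0 := by positivity
  have e1 : ((n + k).choose (2 * k + 1) : ℚ)
      = (n + k).choose (2 * k) * (n - k) / (2 * k + 1) := by
    rw [eq_div_iff h4, h1]; ring
  have e2 : ((n + k + 1).choose (2 * k + 1 + 1) : ℚ) =
      (n + k + 1) * (n + k).choose (2 * k + 1) / (2 * (k + 1)) := by
    rw [eq_div_iff (by positivity), ← h2]; ring
  have e3 : ((k + 1).centralBinom : ℚ) = 2 * (2 * k + 1) * k.centralBinom / (k + 1) := by
    rw [eq_div_iff h5, ← h3]; ring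
  rw [e2, e1, e3]
  field_simp
  ring

lemma trinomialSqTerm_eq_zero {n k : ℕ} (h : n < k) : trinomialSqTerm n k = 0 := by
  simp [trinomialSqTerm, Nat.choose_eq_zero_of_lt (show n + k < 2 * k by lia)]

lemma sum_trinomialSqTerm_eq (n K : ℕ) (hK : n < K) (f : ℕ → ℚ) :
    ∑ k ∈ range K, f k * trinomialSqTerm n k
      = ∑ k ∈ range (n + 1), f k * trinomialSqTerm n k := by
  symm
  refine sum_subset (range_subset_range.2 hK) fun k _ hk => ?_
  rw [trinomialSqTerm_eq_zero (by have := mt mem_range.2 hk; lia), mul_zero]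

lemma sum_trinomialSqTerm_rec (n : ℕ) :
    ((n : ℚ) + 2) ^ 2 * ∑ k ∈ range (n + 3), trinomialSqTerm (n + 2) k
      = 16 * (2 * n + 3) ^ 2 * ∑ k ∈ range (n + 3), trinomialSqTerm (n + 1) k
        - 32 * (2 * n + 3) * ∑ k ∈ range (n + 3), (n + 1 - k) * trinomialSqTerm (n + 1) k
        + 144 * (n + 1) ^ 2 * ∑ k ∈ range (n + 3), trinomialSqTerm n k := by
  rw [← sub_eq_zero]
  simp only [mul_sum]
  rw [← sum_sub_distrib, ← sum_add_distrib, ← sum_sub_distrib]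
  set G : ℕ → ℚ := fun j => -2 * (2 * n + 3) * j ^ 3 * trinomialSqTerm (n + 2) j
    / ((n + 1 + j) * (n + 2 + j)) with hG
  have key : ∀ k ∈ range (n + 3),
      ((n : ℚ) + 2) ^ 2 * trinomialSqTerm (n + 2) k -
        (16 * (2 * n + 3) ^ 2 * trinomialSqTerm (n + 1) k
          - 32 * (2 * n + 3) * ((n + 1 - k) * trinomialSqTerm (n + 1) k)
          + 144 * (n + 1) ^ 2 * trinomialSqTerm n k) = G (k + 1) - G k := by
    intro k _
    have h1 := trinomialSqTerm_succ_left n k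
    have h2 := trinomialSqTerm_succ_left (n + 1) k
    have h3 := trinomialSqTerm_succ_right (n + 2) k
    simp only [hG]
    push_cast at h1 h2 h3 ⊢
    have hn1 : (n : ℚ) + 1 + k ≠ 0 := by positivity
    have hn2 : (n : ℚ) + 2 + k ≠ 0 := by positivity
    have hn3 : (n : ℚ) + 3 + k ≠ 0 := by positivity
    have e2 : trinomialSqTerm (n + 1) k
        = (n + 2 - k) * trinomialSqTerm (n + 2) k / (12 * (n + 2 + k)) := by
      rw [eq_div_iff (by positivity)]; linear_combination h2
    have e1 : trinomialSqTerm n k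
        = (n + 1 - k) * trinomialSqTerm (n + 1) k / (12 * (n + 1 + k)) := by
      rw [eq_div_iff (by positivity)]; linear_combination h1
    have e3 : trinomialSqTerm (n + 2) (k + 1) = (2 * k + 1) * (n + 2 + k + 1) * (n + 2 - k)
        * trinomialSqTerm (n + 2) k / (6 * (k + 1) ^ 3) := by
      rw [eq_div_iff (by positivity)]; linear_combination h3
    rw [e1, e2, e3, show (n : ℚ) + 1 + (k + 1) = n + 2 + k by ring,
      show (n : ℚ) + 2 + (k + 1) = n + 3 + k by ring]
    field_simp
    ring
  rw [sum_congr rfl key, sum_range_sub]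
  simp [hG, trinomialSqTerm_eq_zero (show n + 2 < n + 3 by lia)]

lemma genCentralTrinomial_four_one_sq_aux (n : ℕ) :
    (genCentralTrinomial 4 1 n : ℚ) ^ 2 = ∑ k ∈ range (n + 1), trinomialSqTerm n k ∧
    (genCentralTrinomial 4 1 (n + 1) : ℚ) ^ 2
      = ∑ k ∈ range (n + 2), trinomialSqTerm (n + 1) k ∧
    3 * ((n : ℚ) + 1) * genCentralTrinomial 4 1 (n + 1) * genCentralTrinomial 4 1 n
      = ∑ k ∈ range (n + 2), (n + 1 - k) * trinomialSqTerm (n + 1) k := by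
  induction n with
  | zero =>
    simp [genCentralTrinomial, trinomialSqTerm, sum_range_succ, Nat.centralBinom]
    norm_num
  | succ n ih =>
    obtain ⟨h0, h1, hB⟩ := ih
    have hrec := genCentralTrinomial_four_one_rec n
    have hn : (n : ℚ) + 2 ≠ 0 := by positivity
    have s0 := sum_trinomialSqTerm_eq n (n + 3) (by lia) (fun _ => 1)
    have s1 := sum_trinomialSqTerm_eq (n + 1) (n + 3) (by lia) (fun _ => 1)
    have s2 := sum_trinomialSqTerm_eq (n + 1) (n + 3) (by lia) (fun k => n + 1 - k)
    simp only [one_mul] at s0 s1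
    have hA := sum_trinomialSqTerm_rec n
    rw [s0, s1, s2, ← h0, ← h1, ← hB] at hA
    refine ⟨h1, ?_, ?_⟩
    · have h2 : ((n : ℚ) + 2) ^ 2 ≠ 0 := by positivity
      apply mul_left_cancel₀ h2
      rw [hA]
      linear_combination ((n + 2) * (genCentralTrinomial 4 1 (n + 2) : ℚ)
        + (4 * (2 * n + 3) * genCentralTrinomial 4 1 (n + 1)
        - 12 * (n + 1) * genCentralTrinomial 4 1 n)) * hrec
    · have hterm : ∀ k ∈ range (n + 3),
          (((n + 1 : ℕ) : ℚ) + 1 - k) * trinomialSqTerm (n + 2) k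
            = 12 * (2 * n + 3) * trinomialSqTerm (n + 1) k
              - 12 * ((n + 1 - k) * trinomialSqTerm (n + 1) k) := by
        intro k _
        have h2 := trinomialSqTerm_succ_left (n + 1) k
        push_cast at h2 ⊢
        linear_combination -h2
      rw [sum_congr rfl hterm, sum_sub_distrib, ← mul_sum, ← mul_sum, s1, s2, ← h1, ← hB]
      push_cast
      linear_combination 3 * (genCentralTrinomial 4 1 (n + 1) : ℚ) * hrec

/-- The Clausen-type formula for `T_n(4,1) ^ 2`. -/
lemma genCentralTrinomial_four_one_sq (n : ℕ) :
    genCentralTrinomial 4 1 n ^ 2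
      = ∑ k ∈ range (n + 1), ((n + k).choose (2 * k) : ℤ) * k.centralBinom ^ 2 * 12 ^ (n - k) := by
  have h := (genCentralTrinomial_four_one_sq_aux n).1
  have : ∀ k ∈ range (n + 1), trinomialSqTerm n k
      = (((n + k).choose (2 * k) * k.centralBinom ^ 2 * 12 ^ (n - k) : ℤ) : ℚ) := by
    intro k hk
    push_cast
    rw [trinomialSqTerm, mul_div_assoc, pow_sub₀ _ (by norm_num) (by have := mem_range.1 hk; lia),
      div_eq_mul_inv]
  rw [sum_congr rfl this] at h
  exact_mod_cast h

lemma sum_range_two_mul {M : Type*} [AddCommMonoid M] (f : ℕ → M) (N : ℕ) :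
    ∑ k ∈ range (2 * N), f k = ∑ i ∈ range N, (f (2 * i) + f (2 * i + 1)) := by
  induction N with
  | zero => simp
  | succ N ih =>
    rw [show 2 * (N + 1) = 2 * N + 1 + 1 by ring, sum_range_succ, sum_range_succ, ih,
      sum_range_succ, add_assoc]

/-- Splitting of the binomial expansion of `(s + 1) ^ (2 * n + 1)` by parity. -/
lemma add_one_pow_eq_even_add_odd {R : Type*} [CommRing R] (d : ℤ) (s : R) (hs : s ^ 2 = d)
    (n : ℕ) :
    (s + 1) ^ (2 * n + 1)
      = ((∑ i ∈ range (n + 1), ((2 * n + 1).choose (2 * i) : ℤ) * d ^ i : ℤ) : R)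
        + s * ((∑ i ∈ range (n + 1), ((2 * n + 1).choose (2 * i + 1) : ℤ) * d ^ i : ℤ) : R) := by
  rw [add_pow, show 2 * n + 1 + 1 = 2 * (n + 1) by ring, sum_range_two_mul, sum_add_distrib]
  push_cast
  rw [mul_sum]
  congr 1 <;> refine sum_congr rfl fun i _ => ?_
  · rw [pow_mul, hs]; ring
  · rw [pow_succ, pow_mul, hs]; ring

lemma sum_choose_odd_four (n : ℕ) :
    4 * ∑ i ∈ range (n + 1), ((2 * n + 1).choose (2 * i + 1) : ℤ) * 4 ^ i
      = 3 ^ (2 * n + 1) + 1 := by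
  have h1 := add_one_pow_eq_even_add_odd (R := ℤ) 4 2 (by norm_num) n
  have h2 := add_one_pow_eq_even_add_odd (R := ℤ) 4 (-2) (by norm_num) n
  rw [show (-2 : ℤ) + 1 = -1 by norm_num, Odd.neg_one_pow ⟨n, rfl⟩] at h2
  norm_num only [Int.cast_id] at h1 h2
  linarith

lemma sum_choose_odd_neg_three (n : ℕ) (h : ¬ 3 ∣ 2 * n + 1) :
    ∃ σ : ℤ, σ ^ 2 = 1 ∧
      ∑ i ∈ range (n + 1), ((2 * n + 1).choose (2 * i + 1) : ℤ) * (-3) ^ i = σ * 4 ^ n := by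
  have h1 := add_one_pow_eq_even_add_odd (R := ℤ√(-3)) (-3) Zsqrtd.sqrtd
    (by rw [sq, Zsqrtd.dmuld]) n
  have him := congrArg Zsqrtd.im h1
  have h3 : ((Zsqrtd.sqrtd : ℤ√(-3)) + 1) ^ 3 = ((-8 : ℤ) : ℤ√(-3)) := by
    ext <;> simp [pow_succ]
  generalize (∑ i ∈ range (n + 1), ((2 * n + 1).choose (2 * i) : ℤ) * (-3) ^ i) = E at him
  generalize (∑ i ∈ range (n + 1), ((2 * n + 1).choose (2 * i + 1) : ℤ) * (-3) ^ i) = O at him ⊢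
  have hr : (((Zsqrtd.sqrtd : ℤ√(-3)) + 1) ^ (2 * n + 1)).im = O := by
    rw [him]; simp
  obtain ⟨k, hk | hk⟩ : ∃ k, 2 * n + 1 = 3 * k + 1 ∨ 2 * n + 1 = 3 * k + 2 :=
    ⟨(2 * n + 1) / 3, by lia⟩
  all_goals
    have h8 : (-8 : ℤ) ^ k = (-1) ^ k * 2 ^ (3 * k) := by
      rw [pow_mul, ← mul_pow]; norm_num
    rw [hk, pow_add, pow_mul, h3, ← Int.cast_pow] at hr
    refine ⟨(-1) ^ k, by rw [← pow_mul, mul_comm, pow_mul]; simp, ?_⟩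
    rw [← hr, show (4 : ℤ) = 2 ^ 2 by norm_num, ← pow_mul]
    generalize (-8 : ℤ) ^ k = c at h8 ⊢
  · rw [show 2 * n = 3 * k by lia, ← h8]
    simp
  · rw [show 2 * n = 3 * k + 1 by lia, pow_succ (2 : ℤ), ← mul_assoc, ← h8]
    simp [pow_two]

lemma cast_choose_pred (p : ℕ) [Fact p.Prime] (j : ℕ) (hj : j < p) :
    ((p - 1).choose j : ZMod p) = (-1) ^ j := by
  induction j with
  | zero => simp
  | succ j ih =>
    have h0 : ((j + 1 : ℕ) : ZMod p) ≠ 0 := by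
      rw [Ne, ZMod.natCast_eq_zero_iff]
      exact Nat.not_dvd_of_pos_of_lt (by lia) hj
    have h := congrArg (Nat.cast (R := ZMod p)) (Nat.choose_succ_right_eq (p - 1) j)
    have h1 : ((p - 1 - j : ℕ) : ZMod p) = -((j + 1 : ℕ) : ZMod p) := by
      rw [eq_neg_iff_add_eq_zero, ← Nat.cast_add, show p - 1 - j + (j + 1) = p by lia,
        ZMod.natCast_self]
    rw [Nat.cast_mul, Nat.cast_mul, h1, ih (by lia)] at h
    apply mul_right_cancel₀ h0
    rw [h]
    ring

/-- The odd part of a binomial expansion to the exponent `p = 2 * n + 1`, modulo `p ^ 2`. -/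
lemma exists_sum_choose_odd_eq (n : ℕ) [Fact (2 * n + 1).Prime] (d : ℤ) :
    ∃ y : ℤ, ∑ i ∈ range (n + 1), ((2 * n + 1).choose (2 * i + 1) : ℤ) * d ^ i
        = d ^ n + (2 * n + 1 : ℕ) * y ∧
      (y : ZMod (2 * n + 1)) = ∑ i ∈ range n, (d : ZMod (2 * n + 1)) ^ i / (2 * i + 1) := by
  set p := 2 * n + 1 with hp
  have hpp : p.Prime := Fact.out
  refine ⟨∑ i ∈ range n, ((p.choose (2 * i + 1) / p : ℕ) : ℤ) * d ^ i, ?_, ?_⟩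
  · rw [sum_range_succ, ← hp, Nat.choose_self, add_comm, mul_sum]
    congr 1
    · simp
    · refine sum_congr rfl fun i hi => ?_
      have hi := mem_range.1 hi
      have hd : p ∣ p.choose (2 * i + 1) := hpp.dvd_choose_self (by lia) (by lia)
      rw [← mul_assoc, ← Nat.cast_mul, Nat.mul_div_cancel' hd]
  · simp only [Int.cast_sum, Int.cast_mul, Int.cast_natCast, Int.cast_pow]
    refine sum_congr rfl fun i hi => ?_
    have hi := mem_range.1 hi
    have hd : p ∣ p.choose (2 * i + 1) := hpp.dvd_choose_self (by lia) (by lia)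
    obtain ⟨c, hc⟩ := hd
    have h1 := Nat.add_one_mul_choose_eq (p - 1) (2 * i)
    rw [show p - 1 + 1 = p by lia, hc, mul_assoc] at h1
    have h2 := congrArg (Nat.cast (R := ZMod p)) (Nat.eq_of_mul_eq_mul_left hpp.pos h1)
    rw [cast_choose_pred p _ (by lia), pow_mul] at h2
    have h0 : ((2 * i + 1 : ℕ) : ZMod p) ≠ 0 := by
      rw [Ne, ZMod.natCast_eq_zero_iff]
      exact Nat.not_dvd_of_pos_of_lt (by lia) (by lia)
    rw [hc, Nat.mul_div_cancel_left _ hpp.pos]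
    push_cast at h0 h2
    rw [eq_div_iff h0]
    linear_combination -(d : ZMod p) ^ i * h2

/-- The logarithmic sums in terms of the Fermat quotient `q` of `3`. -/
lemma log_sums_eq_fermatQuotient (n : ℕ) [Fact (2 * n + 1).Prime] (hn : 3 < 2 * n + 1) (q : ℤ)
    (hq : (3 : ℤ) ^ (2 * n) = 1 + (2 * n + 1 : ℕ) * q) :
    4 * (∑ i ∈ range n, (4 : ZMod (2 * n + 1)) ^ i / (2 * i + 1)
      + (-3) ^ n * ∑ i ∈ range n, (-3 : ZMod (2 * n + 1)) ^ i / (2 * i + 1)) = q ∧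
    (4 : ZMod (2 * n + 1)) ^ n = 1 ∧ ((-3 : ZMod (2 * n + 1)) ^ n) ^ 2 = 1 := by
  obtain ⟨y₁, hy₁, hc₁⟩ := exists_sum_choose_odd_eq n 4
  obtain ⟨y₂, hy₂, hc₂⟩ := exists_sum_choose_odd_eq n (-3)
  have h3 : ¬ 3 ∣ 2 * n + 1 := by
    rw [Nat.prime_dvd_prime_iff_eq Nat.prime_three Fact.out]; lia
  obtain ⟨σ, hσ, hO⟩ := sum_choose_odd_neg_three n h3
  have hO4 := sum_choose_odd_four n
  rw [hy₁] at hO4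
  rw [hy₂] at hO
  have hp0 : ((2 * n + 1 : ℕ) : ℤ) ≠ 0 := by positivity
  have hsq : (((-3 : ℤ)) ^ n) ^ 2 = 3 ^ (2 * n) := by
    rw [← pow_mul, mul_comm, pow_mul, pow_mul]; norm_num
  set p := 2 * n + 1 with hp
  have hpz : ((p : ℕ) : ZMod p) = 0 := ZMod.natCast_self p
  have h20 : (2 : ZMod p) ≠ 0 := by
    have : ((2 : ℕ) : ZMod p) ≠ 0 := by
      rw [Ne, ZMod.natCast_eq_zero_iff]
      exact Nat.not_dvd_of_pos_of_lt (by lia) (by lia)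
    simpa using this
  have h4 : (4 : ZMod p) ^ n = 1 := by
    have := ZMod.pow_card_sub_one_eq_one h20
    rw [show p - 1 = 2 * n by lia, pow_mul] at this
    rw [← this]; norm_num
  obtain ⟨r, hr⟩ : (p : ℤ) ∣ 4 ^ n - 1 := by
    rw [← ZMod.intCast_zmod_eq_zero_iff_dvd]
    push_cast
    rw [h4, sub_self]
  have e1 : 3 * q = 4 * r + 4 * y₁ := by
    apply mul_left_cancel₀ hp0
    rw [hp, pow_succ, hq, ← hp] at hO4
    linear_combination -hO4 + 4 * hr
  set u : ℤ := (-3) ^ n with hu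
  have e2 : u = σ + p * (σ * r - y₂) := by linear_combination hO + σ * hr
  have e3 : q = 2 * σ * (σ * r - y₂) + p * (σ * r - y₂) ^ 2 := by
    apply mul_left_cancel₀ hp0
    rw [hq] at hsq
    rw [e2] at hsq
    linear_combination -hsq + hσ
  have k0 := congrArg (Int.cast (R := ZMod p)) hσ
  have k1 := congrArg (Int.cast (R := ZMod p)) e1
  have k2 := congrArg (Int.cast (R := ZMod p)) e2
  have k3 := congrArg (Int.cast (R := ZMod p)) e3
  push_cast [hu, hpz] at k0 k1 k2 k3 hc₁ hc₂
  refine ⟨?_, h4, ?_⟩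
  · rw [← hc₁, ← hc₂, k2]
    linear_combination -k1 + 2 * k3 + 4 * r * k0
  · rw [k2]; linear_combination k0

section Convolution

variable {R : Type*} [CommRing R]

lemma sum_antidiagonal_fst_mul_centralBinom (f : ℕ → R) (N : ℕ) :
    ∑ x ∈ antidiagonal (N + 1), (x.1 : R) * x.1.centralBinom * f x.2
      = ∑ x ∈ antidiagonal N, (4 * x.1 + 2) * x.1.centralBinom * f x.2 := by
  rw [Finset.Nat.antidiagonal_succ, sum_cons, sum_map]
  simp only [Nat.cast_zero, zero_mul, zero_add]
  refine sum_congr rfl fun x _ => ?_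
  have h := cast_succ_mul_centralBinom_succ (R := R) x.1
  change ((x.1 + 1 : ℕ) : R) * (x.1 + 1).centralBinom * f x.2 = _
  push_cast
  linear_combination f x.2 * h

lemma sum_antidiagonal_centralBinom_mul_centralBinom_int (N : ℕ) :
    ∑ x ∈ antidiagonal N, (x.1.centralBinom : ℤ) * x.2.centralBinom = 4 ^ N := by
  induction N with
  | zero => simp
  | succ N ih =>
    have hswap (M : ℕ) (c d : ℤ) :
        2 * ∑ x ∈ antidiagonal M, (c * x.1 + d) * x.1.centralBinom * x.2.centralBinom
          = (c * M + 2 * d) * ∑ x ∈ antidiagonal M, (x.1.centralBinom : ℤ) * x.2.centralBinom := by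
      rw [two_mul]
      nth_rw 2 [← Finset.Nat.sum_antidiagonal_swap]
      rw [← sum_add_distrib, mul_sum]
      refine sum_congr rfl fun x hx => ?_
      rw [← mem_antidiagonal.1 hx]
      simp only [Prod.fst_swap, Prod.snd_swap]
      push_cast
      ring
    have h1 := sum_antidiagonal_fst_mul_centralBinom (R := ℤ) (fun j => j.centralBinom) N
    have h2 := hswap (N + 1) 1 0
    have h3 := hswap N 4 2
    simp only [one_mul, add_zero, mul_zero] at h2
    rw [h1, h3, ih] at h2
    have h0 : ((N + 1 : ℕ) : ℤ) ≠ 0 := by positivity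
    apply mul_left_cancel₀ h0
    rw [← h2]
    push_cast
    ring

end Convolution

section Field

variable {K : Type*} [Field K]

lemma sum_antidiagonal_centralBinom_mul_centralBinom_div (N : ℕ)
    (h : ∀ j ≤ N, (2 * j + 1 : K) ≠ 0) :
    (2 * N + 1) * N.centralBinom *
      ∑ x ∈ antidiagonal N, (x.1.centralBinom : K) * (x.2.centralBinom / (2 * x.2 + 1))
        = 16 ^ N := by
  induction N with
  | zero => simp
  | succ N ih =>
    have hs (M : ℕ) : ∑ x ∈ antidiagonal M, (x.1.centralBinom : K) * x.2.centralBinom = 4 ^ M := by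
      exact_mod_cast congrArg (Int.cast (R := K))
        (sum_antidiagonal_centralBinom_mul_centralBinom_int M)
    have ih := ih fun j hj => h j (by lia)
    set c : ℕ → K := fun M =>
      ∑ x ∈ antidiagonal M, (x.1.centralBinom : K) * (x.2.centralBinom / (2 * x.2 + 1)) with hc
    have hrec : (2 * N + 3) * c (N + 1) = 8 * (N + 1) * c N := by
      have h1 := sum_antidiagonal_fst_mul_centralBinom (R := K)
        (fun j => j.centralBinom / (2 * j + 1)) N
      have h2 : (2 * N + 3) * c (N + 1) = 2 * (∑ x ∈ antidiagonal (N + 1),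
          (x.1 : K) * x.1.centralBinom * (x.2.centralBinom / (2 * x.2 + 1))) + 4 ^ (N + 1) := by
        rw [← hs, hc, mul_sum, mul_sum, ← sum_add_distrib]
        refine sum_congr rfl fun x hx => ?_
        have hx := mem_antidiagonal.1 hx
        have hd := h x.2 (by lia)
        have hN : (x.1 : K) + x.2 = N + 1 := by exact_mod_cast congrArg (Nat.cast (R := K)) hx
        rw [show (2 * N + 3 : K) = 2 * x.1 + (2 * x.2 + 1) by linear_combination -2 * hN]
        field_simp
      have h3 : 2 * (∑ x ∈ antidiagonal N,
          (4 * (x.1 : K) + 2) * x.1.centralBinom * (x.2.centralBinom / (2 * x.2 + 1)))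
            = 8 * (N + 1) * c N - 4 * 4 ^ N := by
        rw [← hs, hc, mul_sum, mul_sum, mul_sum, ← sum_sub_distrib]
        refine sum_congr rfl fun x hx => ?_
        have hx := mem_antidiagonal.1 hx
        have hd := h x.2 (by lia)
        have hN : (x.1 : K) + x.2 = N := by exact_mod_cast congrArg (Nat.cast (R := K)) hx
        rw [← hN]
        field_simp
        ring
      rw [h2, h1, h3]
      ring
    have ha := cast_succ_mul_centralBinom_succ (R := K) N
    change (2 * N + 1) * N.centralBinom * c N = 16 ^ N at ih
    change (2 * ((N + 1 : ℕ) : K) + 1) * (N + 1).centralBinom * c (N + 1) = 16 ^ (N + 1)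
    push_cast
    linear_combination ((N + 1).centralBinom : K) * hrec + 8 * c N * ha + 16 * ih

end Field

section BinomialTransform

variable {R : Type*} [CommRing R]

/-- The alternating binomial transform of a sequence. -/
def altBinomialTransform (e : ℕ → R) (k : ℕ) : R :=
  ∑ i ∈ range (k + 1), (-1) ^ i * k.choose i * e i

lemma altBinomialTransform_eq (e : ℕ → R) {k N : ℕ} (h : k < N) :
    altBinomialTransform e k = ∑ i ∈ range N, (-1) ^ i * k.choose i * e i := by
  refine sum_subset (range_subset_range.2 h) fun i _ hi => ?_
  rw [Nat.choose_eq_zero_of_lt (by have := mt mem_range.2 hi; lia)]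
  simp

lemma altBinomialTransform_succ (e : ℕ → R) (m : ℕ) (h0 : e 0 = 1)
    (he : ∀ i ≤ m, 3 * (2 * i + 3) * e (i + 1) = 8 * (i + 1) * e i + 3) :
    3 * (2 * m + 3) * altBinomialTransform e (m + 1)
      = -2 * (m + 1) * altBinomialTransform e m := by
  have h1 : 3 * ∑ i ∈ range (m + 2), (-1 : R) ^ i * (m + 1).choose i * ((2 * i + 1) * e i)
      = 3 * (2 * m + 3) * altBinomialTransform e (m + 1)
        - 6 * (m + 1) * altBinomialTransform e m := by
    rw [altBinomialTransform_eq e (show m < m + 2 by lia), altBinomialTransform,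
      mul_sum, mul_sum, mul_sum, ← sum_sub_distrib]
    refine sum_congr rfl fun i hi => ?_
    have hi : i ≤ m + 1 := by have := mem_range.1 hi; lia
    have h := congrArg (Nat.cast (R := R)) (Nat.choose_mul_succ_eq m i)
    rw [Nat.cast_mul, Nat.cast_mul, Nat.cast_sub hi] at h
    push_cast at h
    linear_combination 6 * (-1) ^ i * e i * h
  have h2 : ∑ i ∈ range (m + 2), (-1 : R) ^ i * (m + 1).choose i = 0 := by
    have := add_pow (-1 : R) 1 (m + 1)
    simp only [neg_add_cancel, one_pow, mul_one] at this
    rw [← this]; simp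
  have h3 : 3 * ∑ i ∈ range (m + 2), (-1 : R) ^ i * (m + 1).choose i * ((2 * i + 1) * e i)
      = -8 * (m + 1) * altBinomialTransform e m
        + 3 * ∑ i ∈ range (m + 2), (-1 : R) ^ i * (m + 1).choose i := by
    rw [sum_range_succ', sum_range_succ' _ (m + 1), altBinomialTransform, mul_add 3, mul_add 3,
      mul_sum, mul_sum, mul_sum, ← add_assoc, ← sum_add_distrib]
    congr 1
    · refine sum_congr rfl fun i hi => ?_
      have hi := he i (by have := mem_range.1 hi; lia)
      have h := congrArg (Nat.cast (R := R)) (Nat.add_one_mul_choose_eq m i)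
      push_cast at h ⊢
      rw [pow_succ]
      linear_combination -(-1) ^ i * (m + 1).choose (i + 1) * hi + 8 * (-1) ^ i * e i * h
    · simp [h0]
  rw [h2] at h3
  linear_combination h3 - h1

lemma sum_altBinomialTransform (e : ℕ → R) {k N : ℕ} (h : k ≤ N) :
    ∑ j ∈ range k, altBinomialTransform e j
      = ∑ i ∈ range N, (-1) ^ i * k.choose (i + 1) * e i := by
  induction k with
  | zero => simp
  | succ k ih =>
    rw [sum_range_succ, ih (by lia), altBinomialTransform_eq e (show k < N by lia),
      ← sum_add_distrib]
    refine sum_congr rfl fun i _ => ?_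
    rw [Nat.choose_succ_succ]
    push_cast
    ring

end BinomialTransform

/-- The coefficients of the shifted Legendre polynomial of degree `n`. -/
def legendreCoeff (n k : ℕ) : ℤ := (-1) ^ k * n.choose k * (n + k).choose n

lemma legendreCoeff_zero (n : ℕ) : legendreCoeff n 0 = 1 := by simp [legendreCoeff]

lemma legendreCoeff_succ (n k : ℕ) :
    4 * ((k : ℤ) + 1) ^ 2 * legendreCoeff n (k + 1)
      = ((2 * k + 1) ^ 2 - (2 * n + 1) ^ 2) * legendreCoeff n k := by
  have h1 : (n.choose (k + 1) : ℤ) * (k + 1) = n.choose k * (n - k) := by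
    exact_mod_cast cast_choose_succ_right n k
  have h2 : ((n + (k + 1)).choose n : ℤ) * (k + 1) = (n + k).choose n * (n + k + 1) := by
    have := cast_choose_mul_succ (n + k) n
    push_cast at this
    rw [← add_assoc n k 1]
    have h : ((n + k).choose n : ℚ) * (n + k + 1) = (n + k + 1).choose n * (k + 1) := by
      rw [this]; ring
    exact_mod_cast h.symm
  unfold legendreCoeff
  rw [pow_succ]
  linear_combination -4 * (-1) ^ k * ((n + (k + 1)).choose n * (k + 1) * h1
    + n.choose k * (n - k) * h2)

open Polynomial in
lemma sum_legendreCoeff_mul_choose (n m : ℕ) :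
    ∑ k ∈ range (n + 1), legendreCoeff n k * (k.choose m : ℤ)
      = (-1) ^ (n + m) * legendreCoeff n m := by
  have h := congrArg (fun q : ℤ[X] => q.coeff m)
    (neg_one_pow_mul_shiftedLegendre_comp_one_sub_X_eq n)
  have hc (k : ℕ) : ((1 - X : ℤ[X]) ^ k).coeff m = (-1) ^ m * k.choose m := by
    have : (1 - X : ℤ[X]) ^ k = ((1 + X) ^ k).comp (C (-1) * X) := by simp [sub_eq_add_neg]
    rw [this, comp_C_mul_X_coeff, coeff_one_add_X_pow, mul_comm]
  simp only [coeff_shiftedLegendre] at h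
  rw [show ((-1 : ℤ[X]) ^ n) = C ((-1) ^ n) by simp, coeff_C_mul, shiftedLegendre,
    Polynomial.sum_comp, finsetSum_coeff] at h
  simp only [mul_comp, C_comp, X_pow_comp, coeff_C_mul, hc] at h
  change _ = legendreCoeff n m at h
  rw [← h, pow_add, mul_sum, mul_sum]
  refine sum_congr rfl fun k _ => ?_
  rw [legendreCoeff]
  have h1 : ((-1 : ℤ) ^ n) ^ 2 = 1 := by rw [← pow_mul, mul_comm, pow_mul]; simp
  have h2 : ((-1 : ℤ) ^ m) ^ 2 = 1 := by rw [← pow_mul, mul_comm, pow_mul]; simp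
  linear_combination -((-1 : ℤ) ^ k * n.choose k * (n + k).choose n * k.choose m)
    * (((-1 : ℤ) ^ m) ^ 2 * h1 + h2)

lemma sum_legendreCoeff (n : ℕ) : ∑ k ∈ range (n + 1), legendreCoeff n k = (-1) ^ n := by
  simpa [legendreCoeff_zero] using sum_legendreCoeff_mul_choose n 0

lemma sum_legendreCoeff_mul_sum_altBinomialTransform {R : Type*} [CommRing R] (n : ℕ)
    (e : ℕ → R) :
    ∑ k ∈ range (n + 1), (legendreCoeff n k : R) * ∑ j ∈ range k, altBinomialTransform e j
      = -(-1) ^ n * ∑ i ∈ range n, (legendreCoeff n (i + 1) : R) * e i := by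
  have h : ∀ k ∈ range (n + 1),
      (legendreCoeff n k : R) * ∑ j ∈ range k, altBinomialTransform e j
        = ∑ i ∈ range n, (-1) ^ i * e i * ((legendreCoeff n k * (k.choose (i + 1) : ℤ) : ℤ) : R) := by
    intro k hk
    rw [sum_altBinomialTransform e (show k ≤ n by have := mem_range.1 hk; lia), mul_sum]
    refine sum_congr rfl fun i _ => ?_
    push_cast
    ring
  rw [sum_congr rfl h, sum_comm, mul_sum]
  refine sum_congr rfl fun i _ => ?_
  rw [← mul_sum, ← Int.cast_sum, sum_legendreCoeff_mul_choose]
  have h1 : ((-1 : R) ^ i) ^ 2 = 1 := by rw [← pow_mul, mul_comm, pow_mul]; simp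
  push_cast
  rw [pow_add, pow_succ]
  linear_combination -(-1 : R) ^ n * e i * legendreCoeff n (i + 1) * h1

section HalfCharacteristic

variable (K : Type*) [Field K] (n : ℕ) [CharP K (2 * n + 1)]

lemma two_mul_natCast_add_one : 2 * (n : K) + 1 = 0 := by
  exact_mod_cast CharP.cast_eq_zero K (2 * n + 1)

variable {n}

lemma natCast_ne_zero_of_lt {m : ℕ} (h0 : 0 < m) (h : m < 2 * n + 1) : (m : K) ≠ 0 := by
  rw [Ne, CharP.cast_eq_zero_iff K (2 * n + 1)]
  exact Nat.not_dvd_of_pos_of_lt h0 h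

lemma two_mul_add_one_ne_zero {j : ℕ} (h : j < n) : (2 * j + 1 : K) ≠ 0 := by
  exact_mod_cast natCast_ne_zero_of_lt K (n := n) (show 0 < 2 * j + 1 by lia) (by lia)

lemma add_one_ne_zero {j : ℕ} (h : j < n) : (j + 1 : K) ≠ 0 := by
  exact_mod_cast natCast_ne_zero_of_lt K (n := n) (show 0 < j + 1 by lia) (by lia)

lemma two_ne_zero_of_lt (h : 0 < n) : (2 : K) ≠ 0 := by
  exact_mod_cast natCast_ne_zero_of_lt K (n := n) (show 0 < 2 by lia) (by lia)

lemma three_ne_zero_of_lt (h : 3 < 2 * n + 1) : (3 : K) ≠ 0 := by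
  exact_mod_cast natCast_ne_zero_of_lt K (n := n) (show 0 < 3 by lia) h

lemma centralBinom_succ_eq {j : ℕ} (h : j < n) :
    ((j + 1).centralBinom : K) = 2 * (2 * j + 1) * j.centralBinom / (j + 1) := by
  rw [eq_div_iff (add_one_ne_zero K h), mul_comm, cast_succ_mul_centralBinom_succ]

lemma centralBinom_ne_zero {k : ℕ} (h : k ≤ n) : (k.centralBinom : K) ≠ 0 := by
  induction k with
  | zero => simp
  | succ k ih =>
    rw [centralBinom_succ_eq K (show k < n by lia)]
    exact div_ne_zero (mul_ne_zero (mul_ne_zero (two_ne_zero_of_lt K (by lia))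
      (two_mul_add_one_ne_zero K (by lia))) (ih (by lia))) (add_one_ne_zero K (by lia))

lemma choose_mul_neg_four_pow {k : ℕ} (h : k ≤ n) :
    (n.choose k : K) * (-4) ^ k = k.centralBinom := by
  induction k with
  | zero => simp
  | succ k ih =>
    have h1 := congrArg (Nat.cast (R := K)) (Nat.choose_succ_right_eq n k)
    rw [Nat.cast_mul, Nat.cast_mul, Nat.cast_sub (by lia)] at h1
    have h2 := cast_succ_mul_centralBinom_succ (R := K) k
    have hp := two_mul_natCast_add_one K n
    apply mul_left_cancel₀ (add_one_ne_zero K (show k < n by lia))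
    rw [h2, ← ih (by lia), pow_succ]
    push_cast at h1
    linear_combination -4 * (-4) ^ k * h1 - 2 * n.choose k * (-4) ^ k * hp

lemma legendreCoeff_mul_pow {k : ℕ} (h : k ≤ n) :
    (legendreCoeff n k : K) * 16 ^ k = (k.centralBinom : K) ^ 2 := by
  induction k with
  | zero => simp [legendreCoeff]
  | succ k ih =>
    have h1 := congrArg (Int.cast (R := K)) (legendreCoeff_succ n k)
    push_cast at h1
    rw [two_mul_natCast_add_one K n] at h1
    have h2 := cast_succ_mul_centralBinom_succ (R := K) k
    have ih := ih (by lia)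
    apply mul_left_cancel₀ (pow_ne_zero 2 (add_one_ne_zero K (show k < n by lia)))
    rw [← mul_pow, h2, pow_succ (16 : K)]
    linear_combination 4 * 16 ^ k * h1 + 4 * (2 * k + 1) ^ 2 * ih

variable {K}

lemma sum_legendreCoeff_mul_sum_eq (hn : 3 < 2 * n + 1) (g : ℕ → K) (g0 : g 0 = 1)
    (hg : ∀ j, j + 1 < n → 3 * (2 * j + 3) * g (j + 1) = -2 * (j + 1) * g j) :
    8 * ∑ k ∈ range (n + 1), (legendreCoeff n k : K) * ∑ j ∈ range k, g j
      = -3 * (-1) ^ n * ∑ k ∈ range n, (k + 1).centralBinom / ((k + 1) * 3 ^ (k + 1))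
          * ∑ i ∈ range (k + 1), (i.centralBinom : K) * 3 ^ i / 16 ^ i := by
  have h2 := two_ne_zero_of_lt K (show 0 < n by lia)
  have h3 := three_ne_zero_of_lt K hn
  have h16 : (16 : K) ≠ 0 := by
    rw [show (16 : K) = 2 ^ 4 by norm_num]; exact pow_ne_zero 4 h2
  set B : ℕ → K := fun k => ∑ i ∈ range (k + 1), (i.centralBinom : K) * 3 ^ i / 16 ^ i with hB
  set e : ℕ → K := fun k => 16 ^ k * B k / ((2 * k + 1) * k.centralBinom * 3 ^ k) with he
  have he0 : e 0 = 1 := by simp [he, hB]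
  have hes (i : ℕ) (hi : i + 1 < n) : 3 * (2 * i + 3) * e (i + 1) = 8 * (i + 1) * e i + 3 := by
    have hBs : B (i + 1) = B i + (i + 1).centralBinom * 3 ^ (i + 1) / 16 ^ (i + 1) := by
      simp only [hB]; rw [sum_range_succ]
    have a1 := centralBinom_ne_zero K (show i + 1 ≤ n by lia)
    have a0 := centralBinom_ne_zero K (show i ≤ n by lia)
    have b0 := two_mul_add_one_ne_zero K (show i < n by lia)
    have b1 := two_mul_add_one_ne_zero K hi
    have c0 := add_one_ne_zero K (show i < n by lia)
    simp only [he]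
    rw [hBs]
    push_cast at b1 ⊢
    rw [show (2 * (i + 1) + 1 : K) = 2 * i + 3 by ring] at b1 ⊢
    rw [centralBinom_succ_eq K (show i < n by lia)]
    field_simp
    ring
  have hge (j : ℕ) (hj : j < n) : altBinomialTransform e j = g j := by
    induction j with
    | zero => simp [altBinomialTransform, he0, g0]
    | succ j ih =>
      have b1 := two_mul_add_one_ne_zero K hj
      push_cast at b1
      rw [show (2 * (j + 1) + 1 : K) = 2 * j + 3 by ring] at b1
      apply mul_left_cancel₀ (mul_ne_zero h3 b1)
      rw [hg j hj, ← ih (by lia)]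
      exact altBinomialTransform_succ e j he0 fun i hi => hes i (by lia)
  have hM := sum_legendreCoeff_mul_sum_altBinomialTransform n e
  have hM' : ∑ k ∈ range (n + 1), (legendreCoeff n k : K) * ∑ j ∈ range k, g j
      = ∑ k ∈ range (n + 1), (legendreCoeff n k : K) *
          ∑ j ∈ range k, altBinomialTransform e j := by
    refine sum_congr rfl fun k hk => ?_
    congr 1
    exact sum_congr rfl fun j hj =>
      (hge j (by have := mem_range.1 hk; have := mem_range.1 hj; lia)).symm
  rw [hM', hM, mul_sum, mul_sum, mul_sum]
  refine sum_congr rfl fun k hk => ?_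
  have hk := mem_range.1 hk
  have hw := legendreCoeff_mul_pow K (show k + 1 ≤ n by lia)
  have a0 := centralBinom_ne_zero K (show k ≤ n by lia)
  have b0 := two_mul_add_one_ne_zero K hk
  have c0 := add_one_ne_zero K hk
  rw [← eq_div_iff (pow_ne_zero _ h16)] at hw
  change _ = -3 * (-1) ^ n * (_ * B k)
  rw [hw, he, centralBinom_succ_eq K hk]
  field_simp
  ring

end HalfCharacteristic

section ReciprocalBinomials

variable {K : Type*} [Field K]

lemma inv_choose_add_inv_choose {s m : ℕ} (h : m ≤ s)
    (hs : ∀ j ≤ s + 2, 0 < j → (j : K) ≠ 0) :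
    1 / ((s + 2) * ((s + 1).choose m : K)) + 1 / ((s + 2) * ((s + 1).choose (m + 1) : K))
      = 1 / ((s + 1) * (s.choose m : K)) := by
  have hc (t k : ℕ) (ht : t ≤ s + 2) (hk : k ≤ t) : (t.choose k : K) ≠ 0 := by
    have hf (t : ℕ) (ht : t ≤ s + 2) : (t.factorial : K) ≠ 0 := by
      induction t with
      | zero => simp
      | succ t ih =>
        rw [Nat.factorial_succ, Nat.cast_mul]
        exact mul_ne_zero (hs _ ht (by lia)) (ih (by lia))
    intro h0
    have := congrArg (Nat.cast (R := K)) (Nat.choose_mul_factorial_mul_factorial hk)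
    rw [Nat.cast_mul, Nat.cast_mul, h0, zero_mul, zero_mul] at this
    exact hf t ht this.symm
  have h1 := congrArg (Nat.cast (R := K)) (Nat.choose_mul_succ_eq s m)
  rw [Nat.cast_mul, Nat.cast_mul, Nat.cast_sub (by lia)] at h1
  have h2 := congrArg (Nat.cast (R := K)) (Nat.add_one_mul_choose_eq s m)
  push_cast at h1 h2
  have e0 := hc s m (by lia) h
  have e1 := hc (s + 1) m (by lia) (by lia)
  have e2 := hc (s + 1) (m + 1) (by lia) (by lia)
  have f1 : (s + 1 : K) ≠ 0 := by exact_mod_cast hs (s + 1) (by lia) (by lia)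
  have f2 : (s + 2 : K) ≠ 0 := by exact_mod_cast hs (s + 2) (by lia) (by lia)
  have i1 : 1 / ((s + 2) * ((s + 1).choose m : K))
      = (s + 1 - m) / ((s + 2) * ((s + 1) * s.choose m)) := by
    rw [div_eq_div_iff (mul_ne_zero f2 e1) (mul_ne_zero f2 (mul_ne_zero f1 e0))]
    linear_combination (s + 2) * h1
  have i2 : 1 / ((s + 2) * ((s + 1).choose (m + 1) : K))
      = (m + 1) / ((s + 2) * ((s + 1) * s.choose m)) := by
    rw [div_eq_div_iff (mul_ne_zero f2 e2) (mul_ne_zero f2 (mul_ne_zero f1 e0))]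
    linear_combination (s + 2) * h2
  rw [i1, i2]
  field_simp
  ring

lemma sum_pow_div_choose_succ (x : K) (s : ℕ) (hs : ∀ j ≤ s + 2, 0 < j → (j : K) ≠ 0) :
    x * ∑ m ∈ range (s + 1), x ^ m * (1 / ((s + 1) * (s.choose m : K)))
      = (1 + x) * ∑ m ∈ range (s + 2), x ^ m * (1 / ((s + 2) * ((s + 1).choose m : K)))
        - (1 + x ^ (s + 2)) / (s + 2) := by
  have h : ∀ m ∈ range (s + 1), x ^ m * (1 / ((s + 1) * (s.choose m : K)))
      = x ^ m * (1 / ((s + 2) * ((s + 1).choose m : K)))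
        + x ^ m * (1 / ((s + 2) * ((s + 1).choose (m + 1) : K))) := by
    intro m hm
    rw [← mul_add, inv_choose_add_inv_choose (by have := mem_range.1 hm; lia) hs]
  set S := ∑ m ∈ range (s + 2), x ^ m * (1 / ((s + 2) * ((s + 1).choose m : K))) with hS
  have hA : S = ∑ m ∈ range (s + 1), x ^ m * (1 / ((s + 2) * ((s + 1).choose m : K)))
      + x ^ (s + 1) / (s + 2) := by
    rw [hS, sum_range_succ, Nat.choose_self, Nat.cast_one, mul_one, mul_one_div]
  have hB : S = x * ∑ m ∈ range (s + 1), x ^ m * (1 / ((s + 2) * ((s + 1).choose (m + 1) : K)))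
      + 1 / (s + 2) := by
    rw [hS, sum_range_succ', mul_sum, Nat.choose_zero_right, Nat.cast_one, mul_one, pow_zero,
      one_mul]
    congr 1
    exact sum_congr rfl fun m _ => by ring
  rw [sum_congr rfl h, sum_add_distrib, add_div, pow_succ x (s + 1)]
  linear_combination -x * hA - hB

lemma sum_pow_div_choose_neg_four_thirds (s : ℕ) (h3 : (3 : K) ≠ 0)
    (hs : ∀ j ≤ s + 1, 0 < j → (j : K) ≠ 0) :
    ∑ m ∈ range (s + 1), (-4 / 3 : K) ^ m * (1 / ((s + 1) * (s.choose m : K)))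
      = -3 * ∑ j ∈ range (s + 1), 4 ^ (s - j) * ((1 + (-4 / 3 : K) ^ (j + 1)) / (j + 1)) := by
  induction s with
  | zero => simp; field_simp; ring
  | succ s ih =>
    have h := sum_pow_div_choose_succ (-4 / 3 : K) s hs
    rw [ih fun j hj => hs j (by lia)] at h
    have hx : (-4 / 3 : K) * 3 = -4 := by field_simp
    generalize (-4 / 3 : K) = x at h hx ⊢
    have h4 : ∀ j ∈ range (s + 1), (4 : K) ^ (s + 1 - j) * ((1 + x ^ (j + 1)) / (j + 1))
          = 4 * (4 ^ (s - j) * ((1 + x ^ (j + 1)) / (j + 1))) := by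
      intro j hj
      rw [show s + 1 - j = s - j + 1 by have := mem_range.1 hj; lia, pow_succ]
      ring
    have h5 : ((s + 1 : ℕ) : K) + 1 = s + 2 := by push_cast; ring
    rw [sum_range_succ (fun j : ℕ => (4 : K) ^ (s + 1 - j) * ((1 + x ^ (j + 1)) / (j + 1))),
      sum_congr rfl h4, ← mul_sum, Nat.sub_self, pow_zero, one_mul, h5]
    linear_combination 3 * h + hx * (3 * ∑ j ∈ range (s + 1), 4 ^ (s - j) *
      ((1 + x ^ (j + 1)) / (j + 1)) + ∑ m ∈ range (s + 2), x ^ m *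
      (1 / ((s + 2) * ((s + 1).choose m : K))))

end ReciprocalBinomials

section HalfCharacteristicSums

variable {K : Type*} [Field K] {n : ℕ} [CharP K (2 * n + 1)]

lemma natCast_sub_eq {j m : ℕ} (h : j + m = n) : (m : K) = -(2 * j + 1) / 2 := by
  subst h
  rcases Nat.eq_zero_or_pos (j + m) with h0 | h0
  · obtain ⟨rfl, rfl⟩ : j = 0 ∧ m = 0 := by lia
    have := two_mul_natCast_add_one K (0 + 0)
    simp at this
  · rw [eq_div_iff (two_ne_zero_of_lt K h0)]
    have := two_mul_natCast_add_one K (j + m)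
    push_cast at this
    linear_combination this

lemma sum_centralBinom_mul_sum_eq (hn : 3 < 2 * n + 1) :
    ∑ k ∈ range n, (k + 1).centralBinom / (((k : K) + 1) * 3 ^ (k + 1))
        * ∑ i ∈ range (k + 1), (i.centralBinom : K) * 3 ^ i / 16 ^ i
      = -2 * ∑ N ∈ range n, (-4 / 3 : K) ^ (n - N) * ((-4) ^ N / ((2 * N + 1) * N.centralBinom)) := by
  have h2 := two_ne_zero_of_lt K (show 0 < n by lia)
  have h3 := three_ne_zero_of_lt K hn
  have h4 : (-4 : K) ≠ 0 := by
    rw [show (-4 : K) = -2 ^ 2 by norm_num]; exact neg_ne_zero.2 (pow_ne_zero 2 h2)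
  have h16 : (16 : K) = (-4) * (-4) := by norm_num
  set f : ℕ → ℕ → K := fun j i => -2 * ((-4 / 3) ^ (n - (i + j)) / (-4) ^ (i + j))
    * (i.centralBinom * (j.centralBinom / (2 * j + 1))) with hf
  have hterm : ∀ j ∈ range n,
      ((n - 1 - j) + 1).centralBinom / (((n - 1 - j : ℕ) + 1 : K) * 3 ^ ((n - 1 - j) + 1))
        * ∑ i ∈ range ((n - 1 - j) + 1), (i.centralBinom : K) * 3 ^ i / 16 ^ i
      = ∑ i ∈ range (n - j), f j i := by
    intro j hj
    have hj := mem_range.1 hj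
    obtain ⟨m, rfl⟩ : ∃ m, n = j + (m + 1) := ⟨n - j - 1, by lia⟩
    rw [show j + (m + 1) - 1 - j = m by lia, show j + (m + 1) - j = m + 1 by lia, mul_sum]
    refine sum_congr rfl fun i hi => ?_
    have hi := mem_range.1 hi
    obtain ⟨r, rfl⟩ : ∃ r, m = i + r := ⟨m - i, by lia⟩
    have hm := natCast_sub_eq (K := K) (show j + (i + r + 1) = j + (i + r + 1) from rfl)
    have ha := choose_mul_neg_four_pow K (show i + r + 1 ≤ j + (i + r + 1) by lia)
    have hb := choose_mul_neg_four_pow K (show j ≤ j + (i + r + 1) by lia)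
    rw [Nat.choose_symm_add] at hb
    have hd := two_mul_add_one_ne_zero K hj
    rw [← eq_div_iff (pow_ne_zero _ h4)] at hb
    rw [hb] at ha
    rw [Nat.cast_add_one] at hm
    simp only [hf]
    rw [← ha, hm, show j + (i + r + 1) - (i + j) = r + 1 by lia, h16]
    simp only [div_pow, mul_pow, pow_add, pow_one]
    generalize (-4 : K) = y at h4 ⊢
    field_simp
  rw [← sum_range_reflect, sum_congr rfl hterm, ← sum_range_diag_flip, mul_sum]
  refine sum_congr rfl fun N hN => ?_
  have hN := mem_range.1 hN
  rw [← Nat.succ_eq_add_one, ← Finset.Nat.sum_antidiagonal_eq_sum_range_succ f,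
    ← Finset.Nat.sum_antidiagonal_swap]
  have hc := sum_antidiagonal_centralBinom_mul_centralBinom_div (K := K) N
    fun j hj => two_mul_add_one_ne_zero K (show j < n by lia)
  have hd := two_mul_add_one_ne_zero K hN
  have ha := centralBinom_ne_zero K (show N ≤ n by lia)
  have hs : ∀ x ∈ antidiagonal N, f x.swap.1 x.swap.2 = -2 * ((-4 / 3) ^ (n - N) / (-4) ^ N)
      * ((x.1.centralBinom : K) * (x.2.centralBinom / (2 * x.2 + 1))) := by
    intro x hx
    rw [← mem_antidiagonal.1 hx]
    rfl
  rw [mul_comm, ← eq_div_iff (mul_ne_zero hd ha)] at hc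
  rw [sum_congr rfl hs, ← mul_sum, hc, h16, mul_pow]
  generalize (-4 / 3 : K) ^ (n - N) = z
  have := pow_ne_zero N h4
  field_simp

lemma sum_pow_div_centralBinom_eq (hn : 3 < 2 * n + 1) :
    ∑ N ∈ range n, (-4 / 3 : K) ^ (n - N) * ((-4) ^ N / ((2 * N + 1) * N.centralBinom))
      = 4 * (∑ i ∈ range n, (4 : K) ^ i / (2 * i + 1)
        + (-4 / 3) ^ n * ∑ i ∈ range n, (-3 : K) ^ i / (2 * i + 1)) := by
  have h2 := two_ne_zero_of_lt K (show 0 < n by lia)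
  have h3 := three_ne_zero_of_lt K hn
  have h4 : (4 : K) ≠ 0 := by
    rw [show (4 : K) = 2 ^ 2 by norm_num]; exact pow_ne_zero 2 h2
  obtain ⟨s, rfl⟩ : ∃ s, n = s + 1 := ⟨n - 1, by lia⟩
  have h := sum_pow_div_choose_neg_four_thirds s h3
    fun j hj h0 => natCast_ne_zero_of_lt K (n := s + 1) h0 (by lia)
  rw [← sum_range_reflect, ← sum_range_reflect (fun j : ℕ => (4 : K) ^ (s - j) * _)] at h
  have hl : ∀ N ∈ range (s + 1), (-4 / 3 : K) ^ (s + 1 - N) *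
      ((-4) ^ N / ((2 * N + 1) * N.centralBinom)) = 2 / 3 * ((-4 / 3) ^ (s + 1 - 1 - N) *
        (1 / ((s + 1) * (s.choose (s + 1 - 1 - N) : K)))) := by
    intro N hN
    have hN := mem_range.1 hN
    have ha := choose_mul_neg_four_pow K (show N ≤ s + 1 by lia)
    have hc := congrArg (Nat.cast (R := K)) (Nat.add_one_mul_choose_eq s (s - N))
    have hm := natCast_sub_eq (K := K) (show N + (s - N + 1) = s + 1 by lia)
    have hd := two_mul_add_one_ne_zero K hN
    have ha0 := centralBinom_ne_zero K (show N ≤ s + 1 by lia)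
    rw [show s - N + 1 = s + 1 - N by lia, Nat.choose_symm (n := s + 1) (k := N) (by lia)] at hc
    rw [show s - N + 1 = s + 1 - N by lia] at hm
    push_cast at hc
    rw [Nat.add_sub_cancel, hc, show s + 1 - N = s - N + 1 by lia, pow_succ,
      show s - N + 1 = s + 1 - N by lia, hm, ← ha]
    have := pow_ne_zero N (neg_ne_zero.2 h4)
    have hc0 : ((s + 1).choose N : K) ≠ 0 := by
      intro h0
      rw [h0, zero_mul] at ha
      exact ha0 ha.symm
    generalize (-4 / 3 : K) ^ (s - N) = z
    field_simp
    ring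
  have hr : ∀ i ∈ range (s + 1), (4 : K) ^ (s - (s + 1 - 1 - i)) *
      ((1 + (-4 / 3 : K) ^ (s + 1 - 1 - i + 1)) / ((s + 1 - 1 - i : ℕ) + 1))
      = -2 * (4 ^ i / (2 * i + 1) + (-4 / 3) ^ (s + 1) * ((-3) ^ i / (2 * i + 1))) := by
    intro i hi
    have hi := mem_range.1 hi
    have hm := natCast_sub_eq (K := K) (show i + (s - i + 1) = s + 1 by lia)
    have hd := two_mul_add_one_ne_zero K hi
    push_cast at hm
    rw [Nat.add_sub_cancel, hm, Nat.sub_sub_self (by lia)]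
    have hx : (4 : K) ^ i * (-4 / 3) ^ (s - i + 1) = (-4 / 3) ^ (s + 1) * (-3) ^ i := by
      rw [show s + 1 = s - i + 1 + i by lia, pow_add _ _ i, mul_assoc, ← mul_pow,
        show (-4 / 3 * -3 : K) = 4 by field_simp, mul_comm]
    rw [← mul_div_assoc, mul_add, hx]
    field_simp
  rw [sum_congr rfl hl, ← mul_sum, h, sum_congr rfl hr, ← mul_sum, sum_add_distrib, ← mul_sum]
  field_simp
  ring

end HalfCharacteristicSums

/-- The double sum over the coefficients of the shifted Legendre polynomial, in terms of the Fermat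
quotient `q` of `3`. -/
lemma four_mul_sum_legendreCoeff_mul_sum (n : ℕ) [Fact (2 * n + 1).Prime] (hn : 3 < 2 * n + 1)
    (q : ℤ) (hq : (3 : ℤ) ^ (2 * n) = 1 + (2 * n + 1 : ℕ) * q) (g : ℕ → ZMod (2 * n + 1))
    (g0 : g 0 = 1) (hg : ∀ j, j + 1 < n → 3 * (2 * j + 3) * g (j + 1) = -2 * (j + 1) * g j) :
    4 * ∑ k ∈ range (n + 1), (legendreCoeff n k : ZMod (2 * n + 1)) * ∑ j ∈ range k, g j
      = 3 * (-1) ^ n * q := by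
  obtain ⟨h1, h2, h3⟩ := log_sums_eq_fermatQuotient n hn q hq
  have hM := sum_legendreCoeff_mul_sum_eq hn g g0 hg
  rw [sum_centralBinom_mul_sum_eq hn, sum_pow_div_centralBinom_eq hn] at hM
  have h20 := two_ne_zero_of_lt (ZMod (2 * n + 1)) (show 0 < n by lia)
  have h30 := three_ne_zero_of_lt (ZMod (2 * n + 1)) hn
  have h4 : (-4 / 3 : ZMod (2 * n + 1)) ^ n = (-3) ^ n := by
    have h5 : (-4 / 3 : ZMod (2 * n + 1)) ^ n * (-3) ^ n = 1 := by
      rw [← mul_pow, show (-4 / 3 * -3 : ZMod (2 * n + 1)) = 4 by field_simp, h2]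
    linear_combination (-3) ^ n * h5 - (-4 / 3 : ZMod (2 * n + 1)) ^ n * h3
  rw [h4] at hM
  apply mul_left_cancel₀ h20
  linear_combination hM + 6 * (-1) ^ n * h1

section TruncatedSums

variable {R : Type*} [CommRing R]

/-- The truncated generating function of the binomial coefficients `(m + k).choose (2 * k)`. -/
def truncatedChooseSum (P : ℕ) (z : R) (k : ℕ) : R :=
  ∑ m ∈ range P, ((m + k).choose (2 * k) : R) * z ^ m

lemma mul_truncatedChooseSum (P : ℕ) (z : R) (k : ℕ) :
    z * truncatedChooseSum P z k = (1 - z) ^ 2 * truncatedChooseSum P z (k + 1)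
      + z ^ P * (P + k + 1).choose (2 * k + 2) - z ^ (P + 1) * (P + k).choose (2 * k + 2) := by
  unfold truncatedChooseSum
  induction P with
  | zero =>
    simp [Nat.choose_eq_zero_of_lt (show k + 1 < 2 * k + 2 by lia),
      Nat.choose_eq_zero_of_lt (show k < 2 * k + 2 by lia)]
  | succ P ih =>
    have h1 := congrArg (Nat.cast (R := R)) (Nat.choose_succ_succ (P + k + 1) (2 * k + 1))
    have h2 := congrArg (Nat.cast (R := R)) (Nat.choose_succ_succ (P + k) (2 * k + 1))
    have h3 := congrArg (Nat.cast (R := R)) (Nat.choose_succ_succ (P + k) (2 * k))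
    simp only [Nat.succ_eq_add_one, Nat.cast_add] at h1 h2 h3
    rw [sum_range_succ, sum_range_succ, mul_add, ih, show P + 1 + k = P + k + 1 by ring,
      show P + (k + 1) = P + k + 1 by ring, show 2 * (k + 1) = 2 * k + 1 + 1 by ring, h1, h2, h3]
    ring

lemma sq_dvd_two_mul_bracket {p j : ℕ} (z y t : R) (hu : IsUnit ((j + 1 : ℕ) : R)) (hj : j < p)
    (hz : z ^ (p - 1) = 1 + p * y) (ht : ((p + j).choose (2 * j + 1) : R) = p * t) :
    (p : R) ^ 2 ∣ 2 * (z ^ (p - 1) * (p + j + 1).choose (2 * j + 2)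
      - z ^ p * (p + j).choose (2 * j + 2)) - p * t * (1 + z) := by
  have h1 := congrArg (Nat.cast (R := R)) (Nat.add_one_mul_choose_eq (p + j) (2 * j + 1))
  have h2 := congrArg (Nat.cast (R := R)) (Nat.choose_succ_right_eq (p + j) (2 * j + 1))
  rw [show p + j - (2 * j + 1) = p - (j + 1) by lia, Nat.cast_mul, Nat.cast_mul,
    Nat.cast_sub hj, ht] at h2
  rw [Nat.cast_mul, Nat.cast_mul, ht] at h1
  rw [← hu.dvd_mul_left, show z ^ p = z ^ (p - 1) * z by rw [← pow_succ]; congr 1; lia, hz]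
  push_cast at h1 h2 ⊢
  refine ⟨t * (1 + p * y) * (1 - z) + (j + 1) * y * t * (1 + z), ?_⟩
  linear_combination -(1 + p * y) * h1 - z * (1 + p * y) * h2

lemma sq_dvd_truncatedChooseSum {p : ℕ} (z y ρ : R) (t : ℕ → R) {k : ℕ} (hk : k ≤ p)
    (hu : ∀ j < k, IsUnit ((j + 1 : ℕ) : R)) (hz0 : IsUnit z) (hρ : ρ * z = (1 - z) ^ 2)
    (hz : z ^ (p - 1) = 1 + p * y)
    (ht : ∀ j < k, ((p + j).choose (2 * j + 1) : R) = p * t j) :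
    (p : R) ^ 2 ∣ 2 * (ρ ^ k * truncatedChooseSum p z k) - 2 * truncatedChooseSum p z 0
      + p * (1 + z) * ∑ j ∈ range k, ρ ^ j * t j := by
  induction k with
  | zero => simp
  | succ k ih =>
    have ih := ih (by lia) (fun j hj => hu j (by lia)) fun j hj => ht j (by lia)
    have hb := (sq_dvd_two_mul_bracket z y (t k) (hu k (by lia)) hk hz (ht k (by lia))).mul_left
      (ρ ^ k)
    have hF : truncatedChooseSum p z k = ρ * truncatedChooseSum p z (k + 1)
        + (z ^ (p - 1) * (p + k + 1).choose (2 * k + 2)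
          - z ^ p * (p + k).choose (2 * k + 2)) := by
      apply hz0.mul_left_cancel
      rw [mul_truncatedChooseSum, pow_succ z p, show z ^ p = z ^ (p - 1) * z by
        rw [← pow_succ]; congr 1; lia]
      linear_combination -truncatedChooseSum p z (k + 1) * hρ
    rw [hF] at ih
    rw [sum_range_succ]
    refine (dvd_sub ih hb).trans (dvd_of_eq ?_)
    ring

lemma sq_dvd_centralBinom_sq_sub {n k : ℕ} (hk : k ≤ n) (i16 : R) (h16 : 16 * i16 = 1)
    (hu : ∀ j < n, IsUnit ((j + 1 : ℕ) : R)) (h2 : IsUnit (2 : R)) :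
    ((2 * n + 1 : ℕ) : R) ^ 2 ∣ (k.centralBinom : R) ^ 2 * i16 ^ k - legendreCoeff n k := by
  induction k with
  | zero => simp [legendreCoeff]
  | succ k ih =>
    have hk1 := hu k (by lia)
    have h1 := congrArg (Int.cast (R := R)) (legendreCoeff_succ n k)
    have h3 := cast_succ_mul_centralBinom_succ (R := R) k
    rw [← (h2.pow 2).dvd_mul_left, ← (hk1.pow 2).dvd_mul_left]
    obtain ⟨c, hc⟩ := ih (by lia)
    push_cast at h1 hc ⊢
    refine ⟨(2 * k + 1) ^ 2 * c + legendreCoeff n k, ?_⟩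
    rw [pow_succ i16]
    linear_combination (2 * k + 1) ^ 2 * hc - h1
      + 4 * i16 ^ k * i16 * ((k + 1) * (k + 1).centralBinom
        + 2 * (2 * k + 1) * k.centralBinom) * h3
      + (2 * k + 1) ^ 2 * k.centralBinom ^ 2 * i16 ^ k * h16

end TruncatedSums

section WeightedSum

variable {R : Type*} [CommRing R]

lemma sum_genCentralTrinomial_sq_mul_pow (P : ℕ) (c i16 ρ : R) (h12 : 12 * (i16 * ρ) = 1) :
    ∑ m ∈ range P, (genCentralTrinomial 4 1 m : R) ^ 2 * c ^ m
      = ∑ k ∈ range P, (k.centralBinom : R) ^ 2 * i16 ^ k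
        * (ρ ^ k * truncatedChooseSum P (12 * c) k) := by
  have h : ∀ m ∈ range P, (genCentralTrinomial 4 1 m : R) ^ 2 * c ^ m
      = ∑ k ∈ range P, (k.centralBinom : R) ^ 2 * i16 ^ k
        * (ρ ^ k * (((m + k).choose (2 * k) : R) * (12 * c) ^ m)) := by
    intro m hm
    have hm := mem_range.1 hm
    have h1 := congrArg (Int.cast (R := R)) (genCentralTrinomial_four_one_sq m)
    push_cast at h1
    rw [h1, sum_mul]
    symm
    rw [← sum_subset (range_subset_range.2 (show m + 1 ≤ P by lia))]
    · refine sum_congr rfl fun k hk => ?_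
      obtain ⟨r, rfl⟩ : ∃ r, m = k + r := ⟨m - k, by have := mem_range.1 hk; lia⟩
      have h2 : (12 : R) ^ k * (i16 ^ k * ρ ^ k) = 1 := by
        rw [← mul_pow, ← mul_pow, h12, one_pow]
      rw [Nat.add_sub_cancel_left, mul_pow, pow_add 12]
      linear_combination (k.centralBinom : R) ^ 2 * (k + r + k).choose (2 * k) * 12 ^ r
        * c ^ (k + r) * h2
    · intro k _ hk
      rw [Nat.choose_eq_zero_of_lt (by have := mt mem_range.2 hk; lia)]
      simp
  rw [sum_congr rfl h, sum_comm]
  refine sum_congr rfl fun k _ => ?_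
  rw [truncatedChooseSum, mul_sum, mul_sum]

lemma sq_dvd_sum_genCentralTrinomial_sq (n : ℕ) [Fact (2 * n + 1).Prime] (c i16 ρ y : R)
    (t : ℕ → R) (h16 : 16 * i16 = 1) (h12 : 12 * (i16 * ρ) = 1)
    (hu : ∀ j < n, IsUnit ((j + 1 : ℕ) : R)) (h2 : IsUnit (2 : R)) (hz0 : IsUnit (12 * c))
    (hρ : ρ * (12 * c) = (1 - 12 * c) ^ 2)
    (hz : (12 * c) ^ (2 * n) = 1 + (2 * n + 1 : ℕ) * y)
    (ht : ∀ j < n, ((2 * n + 1 + j).choose (2 * j + 1) : R) = (2 * n + 1 : ℕ) * t j) :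
    ((2 * n + 1 : ℕ) : R) ^ 2 ∣
      (12 * c - 1) * (2 * (∑ m ∈ range (2 * n + 1), (genCentralTrinomial 4 1 m : R) ^ 2 * c ^ m)
        - 2 * (-1) ^ n)
      - (2 * n + 1 : ℕ) * (2 * (-1) ^ n * (12 * c) * y - ((12 * c) ^ 2 - 1)
        * ∑ k ∈ range (n + 1), (legendreCoeff n k : R) * ∑ j ∈ range k, ρ ^ j * t j) := by
  rw [sum_genCentralTrinomial_sq_mul_pow (2 * n + 1) c i16 ρ h12]
  generalize 12 * c = z at *
  have hpp : (2 * n + 1).Prime := Fact.out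
  set p : R := ((2 * n + 1 : ℕ) : R) with hp
  set F := truncatedChooseSum (2 * n + 1) z with hF
  have hF0 : (z - 1) * F 0 = z * (1 + p * y) - 1 := by
    rw [← hz, hF, truncatedChooseSum]
    simp only [add_zero, mul_zero, Nat.choose_zero_right, Nat.cast_one, one_mul]
    rw [mul_comm, geom_sum_mul, pow_succ']
  have hS : p ^ 2 ∣ ∑ k ∈ range (2 * n + 1), (k.centralBinom : R) ^ 2 * i16 ^ k * (ρ ^ k * F k)
      - ∑ k ∈ range (n + 1), (legendreCoeff n k : R) * (ρ ^ k * F k) := by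
    rw [show 2 * n + 1 = n + 1 + n by ring, sum_range_add, add_sub_right_comm, ← sum_sub_distrib]
    refine dvd_add (dvd_sum fun k hk => ?_) (dvd_sum fun k hk => ?_)
    · rw [← sub_mul]
      exact (sq_dvd_centralBinom_sq_sub (by have := mem_range.1 hk; lia) i16 h16 hu h2).mul_right _
    · have hk := mem_range.1 hk
      have hd : (2 * n + 1) ∣ (n + 1 + k).centralBinom :=
        hpp.dvd_choose (by lia) (by lia) (by lia)
      rw [mul_assoc]
      refine Dvd.dvd.mul_right (pow_dvd_pow_of_dvd ?_ 2) _
      exact Nat.cast_dvd_cast hd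
  have hH : p ^ 2 ∣ ∑ k ∈ range (n + 1), (legendreCoeff n k : R) * (2 * (ρ ^ k * F k) - 2 * F 0
      + p * (1 + z) * ∑ j ∈ range k, ρ ^ j * t j) := by
    refine dvd_sum fun k hk => Dvd.dvd.mul_left ?_ _
    have hk := mem_range.1 hk
    exact sq_dvd_truncatedChooseSum z y ρ t (by lia) (fun j hj => hu j (by lia)) hz0 hρ hz
      fun j hj => ht j (by lia)
  have hw : ∑ k ∈ range (n + 1), (legendreCoeff n k : R) = (-1) ^ n := by
    exact_mod_cast congrArg (Int.cast (R := R)) (sum_legendreCoeff n)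
  have hH' : ∑ k ∈ range (n + 1), (legendreCoeff n k : R) * (2 * (ρ ^ k * F k) - 2 * F 0
      + p * (1 + z) * ∑ j ∈ range k, ρ ^ j * t j)
      = 2 * (∑ k ∈ range (n + 1), (legendreCoeff n k : R) * (ρ ^ k * F k)) - 2 * F 0 * (-1) ^ n
        + p * (1 + z) * ∑ k ∈ range (n + 1), (legendreCoeff n k : R)
          * ∑ j ∈ range k, ρ ^ j * t j := by
    rw [← hw, mul_sum, mul_sum, mul_sum, ← sum_sub_distrib, ← sum_add_distrib]
    exact sum_congr rfl fun k _ => by ring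
  rw [hH'] at hH
  refine (dvd_add (hS.mul_left (2 * (z - 1))) (hH.mul_left (z - 1))).trans (dvd_of_eq ?_)
  linear_combination -2 * (-1) ^ n * hF0

end WeightedSum

lemma isUnit_natCast_of_lt {p : ℕ} [Fact p.Prime] {m : ℕ} (h0 : 0 < m) (h : m < p) :
    IsUnit (m : ℤ_[p]) := by
  rw [PadicInt.isUnit_iff, PadicInt.norm_natCast_eq_one_iff]
  exact Nat.coprime_of_lt_prime h0.ne' h Fact.out

lemma natCast_dvd_of_toZMod_eq_zero {p : ℕ} [Fact p.Prime] {x : ℤ_[p]}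
    (h : PadicInt.toZMod x = 0) : (p : ℤ_[p]) ∣ x := by
  rw [← RingHom.mem_ker, PadicInt.ker_toZMod, PadicInt.maximalIdeal_eq_span_p,
    Ideal.mem_span_singleton] at h
  exact h

/-- A recurrence modulo `p = 2 * n + 1` for the quotients `(p + i).choose (2 * i + 1) / p`. -/
lemma choose_div_prime_rec {n j : ℕ} [Fact (2 * n + 1).Prime] (hj : j + 1 < n) (t : ℕ → ℕ)
    (ht : ∀ i < n, (2 * n + 1 + i).choose (2 * i + 1) = (2 * n + 1) * t i) :
    2 * (2 * j + 3) * (t (j + 1) : ZMod (2 * n + 1)) = -(j + 1) * t j := by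
  have h1 := Nat.add_one_mul_choose_eq (2 * n + 1 + j) (2 * j + 2)
  have h2 := Nat.choose_succ_right_eq (2 * n + 1 + j) (2 * j + 1)
  rw [ht j (by lia)] at h2
  rw [show 2 * n + 1 + j + 1 = 2 * n + 1 + (j + 1) by ring,
    show 2 * j + 2 + 1 = 2 * (j + 1) + 1 by ring, ht (j + 1) hj] at h1
  have h3 : t (j + 1) * (2 * (j + 1) + 1) * (2 * (j + 1))
      = (2 * n + 1 + (j + 1)) * (t j * (2 * n + 1 - (j + 1))) := by
    apply Nat.eq_of_mul_eq_mul_left (show 0 < 2 * n + 1 by lia)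
    rw [show 2 * n + 1 + j - (2 * j + 1) = 2 * n + 1 - (j + 1) by lia] at h2
    calc _ = (2 * n + 1) * t (j + 1) * (2 * (j + 1) + 1) * (2 * (j + 1)) := by ring
      _ = (2 * n + 1 + (j + 1)) * ((2 * n + 1 + j).choose (2 * j + 1 + 1) * (2 * j + 1 + 1)) := by
        rw [← h1]; ring
      _ = _ := by rw [h2]; ring
  have h4 := congrArg (Nat.cast (R := ZMod (2 * n + 1))) h3
  rw [Nat.cast_mul _ (t j * _), Nat.cast_mul (t j), Nat.cast_sub (show j + 1 ≤ 2 * n + 1 by lia),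
    Nat.cast_add (2 * n + 1), ZMod.natCast_self] at h4
  apply mul_left_cancel₀ (add_one_ne_zero (ZMod (2 * n + 1)) (show j < n by lia))
  push_cast at h4
  linear_combination h4

/-- The supercongruence for `∑ T_m(4,1) ^ 2 * c ^ m`, for units `12 * c` with
`4 * (12 * c) = 3 * (1 - 12 * c) ^ 2`, that is, `12 * c = 3` or `12 * c = 1 / 3`. -/
lemma sq_dvd_sum_sub (n : ℕ) [Fact (2 * n + 1).Prime] (hn : 3 < 2 * n + 1)
    (q : ℤ) (hq : (3 : ℤ) ^ (2 * n) = 1 + (2 * n + 1 : ℕ) * q) (c y : ℤ_[2 * n + 1])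
    (hc0 : IsUnit (12 * c)) (hc1 : IsUnit (12 * c - 1)) (hc : 4 * (12 * c) = 3 * (1 - 12 * c) ^ 2)
    (hy : (12 * c) ^ (2 * n) = 1 + (2 * n + 1 : ℕ) * y)
    (hyq : 8 * PadicInt.toZMod (12 * c) * PadicInt.toZMod y
      = 3 * (PadicInt.toZMod (12 * c) ^ 2 - 1) * (q : ZMod (2 * n + 1))) :
    ((2 * n + 1 : ℕ) : ℤ_[2 * n + 1]) ^ 2 ∣
      (∑ m ∈ range (2 * n + 1), (genCentralTrinomial 4 1 m : ℤ_[2 * n + 1]) ^ 2 * c ^ m)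
        - (-1) ^ n := by
  have hpp : (2 * n + 1).Prime := Fact.out
  have h2 : IsUnit (2 : ℤ_[2 * n + 1]) := by
    exact_mod_cast isUnit_natCast_of_lt (p := 2 * n + 1) (show 0 < 2 by lia) (by lia)
  have h3 : IsUnit (3 : ℤ_[2 * n + 1]) := by
    exact_mod_cast isUnit_natCast_of_lt (p := 2 * n + 1) (show 0 < 3 by lia) hn
  obtain ⟨i2, hi2⟩ := h2.exists_right_inv
  obtain ⟨i3, hi3⟩ := h3.exists_right_inv
  have hi2' : 16 * i2 ^ 4 = 1 := by
    rw [show (16 : ℤ_[2 * n + 1]) = 2 ^ 4 by norm_num, ← mul_pow, hi2, one_pow]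
  set t : ℕ → ℕ := fun j => (2 * n + 1 + j).choose (2 * j + 1) / (2 * n + 1) with ht
  have htp : ∀ j < n, (2 * n + 1 + j).choose (2 * j + 1) = (2 * n + 1) * t j := fun j hj =>
    (Nat.mul_div_cancel' (hpp.dvd_choose (by lia) (by lia) (by lia))).symm
  have hD := sq_dvd_sum_genCentralTrinomial_sq n c (i2 ^ 4) (4 * i3) y
    (fun j => (t j : ℤ_[2 * n + 1])) hi2' (by linear_combination 3 * i3 * hi2' + hi3)
    (fun j hj => isUnit_natCast_of_lt (by lia) (by lia)) h2 hc0
    (by linear_combination i3 * hc + (1 - 12 * c) ^ 2 * hi3) hy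
    (fun j hj => by rw [htp j hj, Nat.cast_mul])
  set K := ZMod (2 * n + 1)
  have hi3K : 3 * PadicInt.toZMod i3 = (1 : K) := by
    rw [← map_one PadicInt.toZMod, ← hi3, map_mul, map_ofNat]
  have hM := four_mul_sum_legendreCoeff_mul_sum n hn q hq
    (fun j => PadicInt.toZMod ((4 * i3) ^ j * (t j : ℤ_[2 * n + 1]))) (by
      have h0 : t 0 = 1 := by simp [ht]
      simp [h0]) (by
      intro j hj
      have := choose_div_prime_rec hj t htp
      simp only [map_mul, map_pow, map_natCast, map_ofNat]
      rw [pow_succ]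
      linear_combination 4 * (2 * j + 3) * (4 * PadicInt.toZMod i3) ^ j * t (j + 1) * hi3K
        + 2 * (4 * PadicInt.toZMod i3) ^ j * this)
  have hbr : ((2 * n + 1 : ℕ) : ℤ_[2 * n + 1]) ∣ 2 * (-1) ^ n * (12 * c) * y - ((12 * c) ^ 2 - 1)
      * ∑ k ∈ range (n + 1), (legendreCoeff n k : ℤ_[2 * n + 1])
        * ∑ j ∈ range k, (4 * i3) ^ j * (t j : ℤ_[2 * n + 1]) := by
    rw [← (h2.pow 2).dvd_mul_left]
    refine natCast_dvd_of_toZMod_eq_zero ?_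
    simp only [map_mul, map_sub, map_pow, map_neg, map_one, map_sum, map_natCast, map_intCast,
      map_ofNat] at hM hyq ⊢
    linear_combination (-1) ^ n * hyq
      - ((12 * PadicInt.toZMod c) ^ 2 - 1) * hM
  have hD' := dvd_add hD (pow_two ((2 * n + 1 : ℕ) : ℤ_[2 * n + 1]) ▸ mul_dvd_mul_left _ hbr)
  rw [sub_add_cancel, hc1.dvd_mul_left, ← mul_sub, h2.dvd_mul_left] at hD'
  exact hD'

lemma norm_sum_div_pow_sub_le (n : ℕ) [Fact (2 * n + 1).Prime] (b : ℚ_[2 * n + 1])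
    (c : ℤ_[2 * n + 1]) (hbc : (c : ℚ_[2 * n + 1]) = b⁻¹)
    (h : ((2 * n + 1 : ℕ) : ℤ_[2 * n + 1]) ^ 2 ∣
      (∑ m ∈ range (2 * n + 1), (genCentralTrinomial 4 1 m : ℤ_[2 * n + 1]) ^ 2 * c ^ m)
        - (-1) ^ n) :
    ‖(∑ m ∈ range (2 * n + 1), (genCentralTrinomial 4 1 m : ℚ_[2 * n + 1]) ^ 2 / b ^ m)
      - (-1) ^ n‖ ≤ (((2 * n + 1 : ℕ) : ℝ)⁻¹) ^ 2 := by
  rw [← Ideal.mem_span_singleton, ← PadicInt.norm_le_pow_iff_mem_span_pow, PadicInt.norm_def] at h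
  push_cast [PadicInt.coe_sum, hbc] at h
  simp only [div_eq_mul_inv, ← inv_pow]
  simpa [zpow_neg] using h

theorem sum_T41_sq (p : ℕ) [Fact p.Prime] (hp : 3 < p) :
    ‖(∑ k ∈ Finset.range p,
        (genCentralTrinomial 4 1 k : ℚ_[p]) ^ 2 / (4 : ℚ_[p]) ^ k) -
      (-1 : ℚ_[p]) ^ ((p - 1) / 2)‖ ≤ (p : ℝ)⁻¹ ^ 2 ∧
    ‖(∑ k ∈ Finset.range p,
        (genCentralTrinomial 4 1 k : ℚ_[p]) ^ 2 / (36 : ℚ_[p]) ^ k) -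
      (-1 : ℚ_[p]) ^ ((p - 1) / 2)‖ ≤ (p : ℝ)⁻¹ ^ 2 := by
  obtain ⟨n, rfl⟩ : ∃ n, p = 2 * n + 1 := by
    exact (Fact.out : p.Prime).odd_of_ne_two (by lia)
  rw [show (2 * n + 1 - 1) / 2 = n by lia]
  have h2 : IsUnit (2 : ℤ_[2 * n + 1]) := by
    exact_mod_cast isUnit_natCast_of_lt (p := 2 * n + 1) (show 0 < 2 by lia) (by lia)
  have h3 : IsUnit (3 : ℤ_[2 * n + 1]) := by
    exact_mod_cast isUnit_natCast_of_lt (p := 2 * n + 1) (show 0 < 3 by lia) hp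
  obtain ⟨i2, hi2⟩ := h2.exists_right_inv
  obtain ⟨i3, hi3⟩ := h3.exists_right_inv
  have h3K := three_ne_zero_of_lt (ZMod (2 * n + 1)) hp
  obtain ⟨q, hq⟩ : ∃ q : ℤ, (3 : ℤ) ^ (2 * n) = 1 + (2 * n + 1 : ℕ) * q := by
    obtain ⟨q, hq⟩ : ((2 * n + 1 : ℕ) : ℤ) ∣ 3 ^ (2 * n) - 1 := by
      rw [← ZMod.intCast_zmod_eq_zero_iff_dvd]
      have := ZMod.pow_card_sub_one_eq_one h3K
      rw [Nat.add_sub_cancel] at this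
      push_cast
      rw [this, sub_self]
    exact ⟨q, by linear_combination hq⟩
  have hqp : (3 : ℤ_[2 * n + 1]) ^ (2 * n) = 1 + (2 * n + 1 : ℕ) * q := by
    exact_mod_cast congrArg (Int.cast (R := ℤ_[2 * n + 1])) hq
  constructor
  · have hz : 12 * i2 ^ 2 = 3 := by linear_combination 3 * (2 * i2 + 1) * hi2
    refine norm_sum_div_pow_sub_le n 4 (i2 ^ 2) ?_ (sq_dvd_sum_sub n hp q hq _ q ?_ ?_ ?_ ?_ ?_)
    · apply eq_inv_of_mul_eq_one_left
      have : i2 ^ 2 * 4 = 1 := by linear_combination (2 * i2 + 1) * hi2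
      exact_mod_cast congrArg ((↑) : ℤ_[2 * n + 1] → ℚ_[2 * n + 1]) this
    all_goals rw [hz]
    · exact h3
    · convert h2 using 1; norm_num
    · norm_num
    · exact hqp
    · simp only [map_ofNat, map_intCast]; ring
  · have hz : 12 * (i2 * i3) ^ 2 = i3 := by
      linear_combination 3 * i3 ^ 2 * (2 * i2 + 1) * hi2 + i3 * hi3
    have hi3u : IsUnit i3 := IsUnit.of_mul_eq_one 3 (by linear_combination hi3)
    have hi3p : (3 : ℤ_[2 * n + 1]) ^ (2 * n) * i3 ^ (2 * n) = 1 := by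
      rw [← mul_pow, hi3, one_pow]
    refine norm_sum_div_pow_sub_le n 36 ((i2 * i3) ^ 2) ?_
      (sq_dvd_sum_sub n hp q hq _ (-q * i3 ^ (2 * n)) ?_ ?_ ?_ ?_ ?_)
    · apply eq_inv_of_mul_eq_one_left
      have : (i2 * i3) ^ 2 * 36 = 1 := by
        linear_combination (2 * i2 + 1) * hi2 * (3 * i3) ^ 2 + (3 * i3 + 1) * hi3
      exact_mod_cast congrArg ((↑) : ℤ_[2 * n + 1] → ℚ_[2 * n + 1]) this
    all_goals rw [hz]
    · exact hi3u
    · have := h2.neg.mul hi3u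
      convert this using 1
      linear_combination hi3
    · linear_combination (3 - i3) * hi3
    · linear_combination hi3p - i3 ^ (2 * n) * hqp
    · have hK : 3 * PadicInt.toZMod i3 = (1 : ZMod (2 * n + 1)) := by
        rw [← map_one PadicInt.toZMod, ← hi3, map_mul, map_ofNat]
      have hKp : PadicInt.toZMod i3 ^ (2 * n) = (1 : ZMod (2 * n + 1)) := by
        have h := congrArg PadicInt.toZMod hi3p
        rw [hqp] at h
        simp only [map_mul, map_pow, map_add, map_one, map_natCast, ZMod.natCast_self] at h
        simpa using h
      simp only [map_mul, map_neg, map_pow, map_intCast, hKp]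
      linear_combination -(q : ZMod (2 * n + 1)) * (PadicInt.toZMod i3 + 3) * hK
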